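/- Let K be a field (or commutative ring), n ≥ 1, and a : Fin n → K × K. For a subset I ⊆ {1,…,n} define x(I) = ∏_{i∈I} (a_i)₂ · ∏_{i∉I} (a_i)₁, so in particular x(∅) = ∏_{i=1}^n (a_i)₁. Then for every I ⊆ {1,…,n} with |I| ≥ 2, ∑_{π ∈ Π(I)} (−1)^{|π|−1}·(|π|−1)! · x(∅)^{n−|π|} · ∏_{B∈π} x(B) = 0, where Π(I) is the set of all set partitions of I and |π| denotes the number of blocks of π. -/

import Mathlib

/-- The family `P` is a set partition of `s`. -/
def IsSetPart {α : Type*} (s : Finset α) (P : Finset (Finset α)) : Prop :=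
  ∅ ∉ P ∧ (∀ B ∈ P, B ⊆ s) ∧ (∀ x ∈ s, ∃ B ∈ P, x ∈ B) ∧
    (∀ B ∈ P, ∀ C ∈ P, ∀ x, x ∈ B → x ∈ C → B = C)

theorem isSetPart_parts {α : Type*} [DecidableEq α] {s : Finset α} (π : Finpartition s) :
    IsSetPart s π.parts := by
  refine ⟨fun h => π.bot_notMem h, fun B hB => π.le hB, fun x hx => π.exists_mem hx, ?_⟩
  intro B hB C hC x h1 h2
  exact π.eq_of_mem_parts hB hC h1 h2

/-- The finpartition of a set partition. -/
def IsSetPart.toFin {α : Type*} [DecidableEq α] {s : Finset α} {P : Finset (Finset α)}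
    (h : IsSetPart s P) : Finpartition s where
  parts := P
  supIndep := by
    rw [Finset.supIndep_iff_pairwiseDisjoint]
    intro B hB C hC hne
    exact Finset.disjoint_left.2 fun x h1 h2 => hne (h.2.2.2 B hB C hC x h1 h2)
  sup_parts := by
    ext x
    simp only [Finset.mem_sup, id]
    exact ⟨fun ⟨B, hB, hx⟩ => h.2.1 B hB hx, h.2.2.1 x⟩
  bot_notMem := h.1

theorem merge_isSetPart {α : Type*} [DecidableEq α] {s : Finset α} {a : α}
    {P : Finset (Finset α)} {B : Finset α} (hP : IsSetPart s P) (ha : {a} ∈ P) (hB : B ∈ P)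
    (hne : B ≠ {a}) :
    IsSetPart s (insert (insert a B) ((P.erase {a}).erase B)) ∧ a ∉ B ∧
      insert a B ∉ (P.erase {a}).erase B := by
  obtain ⟨h0, h1, h2, h3⟩ := hP
  have haB : a ∉ B := fun h => hne (h3 B hB {a} ha a h (by simp))
  have has : a ∈ s := h1 _ ha (by simp)
  have key : ∀ C ∈ P, a ∈ C → C = {a} := fun C hC h => h3 C hC {a} ha a h (by simp)
  refine ⟨⟨?_, ?_, ?_, ?_⟩, haB, ?_⟩
  · simp only [Finset.mem_insert, Finset.mem_erase]
    rintro (h | h)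
    · exact Finset.insert_ne_empty _ _ h.symm
    · exact h0 h.2.2
  · intro C hC
    simp only [Finset.mem_insert, Finset.mem_erase] at hC
    rcases hC with rfl | h
    · exact Finset.insert_subset has (h1 B hB)
    · exact h1 C h.2.2
  · intro x hx
    obtain ⟨C, hC, hxC⟩ := h2 x hx
    by_cases hCB : C = B
    · exact ⟨insert a B, by simp, by grind⟩
    by_cases hCa : C = {a}
    · exact ⟨insert a B, by simp, by grind⟩
    exact ⟨C, by grind, hxC⟩
  · intro C hC D hD x hxC hxD
    simp only [Finset.mem_insert, Finset.mem_erase] at hC hD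
    rcases hC with rfl | hC <;> rcases hD with rfl | hD
    · rfl
    · grind
    · grind
    · exact h3 C hC.2.2 D hD.2.2 x hxC hxD
  · intro h
    simp only [Finset.mem_erase] at h
    grind

theorem split_isSetPart {α : Type*} [DecidableEq α] {s : Finset α} {a : α}
    {Q : Finset (Finset α)} {C : Finset α} (hQ : IsSetPart s Q) (hC : C ∈ Q) (ha : a ∈ C)
    (hne : C ≠ {a}) :
    IsSetPart s (insert {a} (insert (C.erase a) (Q.erase C))) ∧ C.erase a ∉ Q ∧ {a} ∉ Q := by
  obtain ⟨h0, h1, h2, h3⟩ := hQ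
  have hn : C.erase a ≠ ∅ := by
    intro h
    rcases Finset.erase_eq_empty_iff C a |>.1 h with h | h
    · simp [h] at ha
    · exact hne h
  refine ⟨⟨?_, ?_, ?_, ?_⟩, ?_, ?_⟩
  · simp only [Finset.mem_insert, Finset.mem_erase]
    rintro (h | h | h)
    · exact Finset.singleton_ne_empty a h.symm
    · exact hn h.symm
    · exact h0 h.2
  · intro D hD
    simp only [Finset.mem_insert, Finset.mem_erase] at hD
    rcases hD with rfl | rfl | h
    · simpa using h1 C hC ha
    · exact (Finset.erase_subset _ _).trans (h1 C hC)
    · exact h1 D h.2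
  · intro x hx
    obtain ⟨D, hD, hxD⟩ := h2 x hx
    by_cases hDC : D = C
    · by_cases hxa : x = a
      · exact ⟨{a}, by simp, by simp [hxa]⟩
      · exact ⟨C.erase a, by simp, by grind⟩
    exact ⟨D, by grind, hxD⟩
  · intro D hD E hE x hxD hxE
    simp only [Finset.mem_insert, Finset.mem_erase] at hD hE
    rcases hD with rfl | rfl | hD <;> rcases hE with rfl | rfl | hE
    · rfl
    · grind
    · grind
    · grind
    · rfl
    · grind
    · grind
    · grind
    · exact h3 D hD.2 E hE.2 x hxD hxE
  · intro h
    obtain ⟨y, hy⟩ := Finset.nonempty_iff_ne_empty.2 hn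
    have := h3 _ h C hC y hy (Finset.mem_of_mem_erase hy)
    rw [← this] at ha
    simp at ha
  · intro h
    exact hne (h3 C hC {a} h a ha (by simp))

open Classical in
theorem sum_setPart {α : Type*} [Fintype α] {K : Type*} [CommRing K]
    {s : Finset α} (hs : 2 ≤ s.card) :
    ∑ P : Finset (Finset α) with IsSetPart s P,
      (-1 : K) ^ (P.card - 1) * (P.card - 1).factorial = 0 := by
  obtain ⟨a, has⟩ : s.Nonempty := Finset.card_pos.1 (by omega)
  set g : ℕ → K := fun k => (-1 : K) ^ (k - 1) * (k - 1).factorial with hg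
  rw [← Finset.sum_filter_add_sum_filter_not _ (fun P => {a} ∈ P)]
  have e1 : ∑ P ∈ ({P : Finset (Finset α) | IsSetPart s P} : Finset _) with {a} ∈ P, g P.card
      = ∑ P ∈ ({P : Finset (Finset α) | IsSetPart s P} : Finset _) with {a} ∈ P,
          ∑ B ∈ P.erase {a}, -g (P.card - 1) := by
    refine Finset.sum_congr rfl fun P hP => ?_
    simp only [Finset.mem_filter, Finset.mem_univ, true_and] at hP
    obtain ⟨hP, ha⟩ := hP
    rw [Finset.sum_const, Finset.card_erase_of_mem ha]
    have h2 : 2 ≤ P.card := by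
      by_contra hlt
      have hPa : P = {{a}} := by
        symm
        apply Finset.eq_of_subset_of_card_le (by simpa using ha)
        simp; omega
      have : s ⊆ {a} := by
        intro x hx
        obtain ⟨B, hB, hxB⟩ := hP.2.2.1 x hx
        rw [hPa, Finset.mem_singleton] at hB
        exact hB ▸ hxB
      have := Finset.card_le_card this
      simp at this
      omega
    obtain ⟨k, hk⟩ : ∃ k, P.card = k + 2 := ⟨P.card - 2, by omega⟩
    simp only [hg, hk]
    simp [Nat.factorial_succ, pow_succ]
    ring
  have e2 : ∑ P ∈ ({P : Finset (Finset α) | IsSetPart s P} : Finset _) with {a} ∉ P, g P.card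
      = ∑ P ∈ ({P : Finset (Finset α) | IsSetPart s P} : Finset _) with {a} ∉ P,
          ∑ C ∈ P with a ∈ C, g P.card := by
    refine Finset.sum_congr rfl fun P hP => ?_
    simp only [Finset.mem_filter, Finset.mem_univ, true_and] at hP
    obtain ⟨hP, ha⟩ := hP
    obtain ⟨B, hB, haB⟩ := hP.2.2.1 a has
    have : P.filter (fun C => a ∈ C) = {B} := by
      ext C
      simp only [Finset.mem_filter, Finset.mem_singleton]
      constructor
      · rintro ⟨h, h'⟩
        exact hP.2.2.2 C h B hB a h' haB
      · rintro rfl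
        exact ⟨hB, haB⟩
    rw [this, Finset.sum_singleton]
  refine (congrArg₂ (· + ·) e1 e2).trans ?_
  simp only [Finset.sum_neg_distrib]
  rw [neg_add_eq_zero, Finset.sum_sigma', Finset.sum_sigma']
  refine Finset.sum_nbij'
    (fun p => ⟨insert (insert a p.2) ((p.1.erase {a}).erase p.2), insert a p.2⟩)
    (fun q => ⟨insert {a} (insert (q.2.erase a) (q.1.erase q.2)), q.2.erase a⟩) ?_ ?_ ?_ ?_ ?_
  · rintro ⟨P, B⟩ h
    simp only [Finset.mem_sigma, Finset.mem_filter, Finset.mem_univ, true_and,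
      Finset.mem_erase] at h ⊢
    obtain ⟨⟨hP, ha⟩, hne, hB⟩ := h
    obtain ⟨m1, m2, m3⟩ := merge_isSetPart hP ha hB hne
    refine ⟨⟨m1, ?_⟩, by simp⟩
    intro h
    have := m1.2.2.2 _ h (insert a B) (by simp) a (by simp) (by simp)
    have hB0 : B = ∅ := by
      rw [← Finset.erase_insert m2, ← this]
      simp
    exact hP.1 (hB0 ▸ hB)
  · rintro ⟨Q, C⟩ h
    simp only [Finset.mem_sigma, Finset.mem_filter, Finset.mem_univ, true_and,
      Finset.mem_erase] at h ⊢
    obtain ⟨⟨hQ, ha⟩, hC, haC⟩ := h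
    obtain ⟨m1, m2, m3⟩ := split_isSetPart hQ hC haC (fun h => ha (h ▸ hC))
    refine ⟨⟨m1, by simp⟩, ?_, by simp⟩
    intro h
    have : a ∈ C.erase a := by rw [h]; simp
    simp at this
  · rintro ⟨P, B⟩ h
    simp only [Finset.mem_sigma, Finset.mem_filter, Finset.mem_univ, true_and,
      Finset.mem_erase] at h
    obtain ⟨⟨hP, ha⟩, hne, hB⟩ := h
    obtain ⟨m1, m2, m3⟩ := merge_isSetPart hP ha hB hne
    simp only [Finset.erase_insert m3, Finset.erase_insert m2]
    rw [Finset.insert_erase (by simp [hne, hB]), Finset.insert_erase ha]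
  · rintro ⟨Q, C⟩ h
    simp only [Finset.mem_sigma, Finset.mem_filter, Finset.mem_univ, true_and,
      Finset.mem_erase] at h
    obtain ⟨⟨hQ, ha⟩, hC, haC⟩ := h
    obtain ⟨m1, m2, m3⟩ := split_isSetPart hQ hC haC (fun h => ha (h ▸ hC))
    have n1 : {a} ∉ insert (C.erase a) (Q.erase C) := by
      simp only [Finset.mem_insert, Finset.mem_erase, not_or]
      refine ⟨fun h => ?_, fun h => m3 h.2⟩
      have : a ∈ C.erase a := by rw [← h]; simp
      simp at this
    have n2 : C.erase a ∉ Q.erase C := fun h => m2 (Finset.mem_of_mem_erase h)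
    simp only [Finset.erase_insert n1, Finset.erase_insert n2, Finset.insert_erase haC,
      Finset.insert_erase hC]
  · rintro ⟨P, B⟩ h
    simp only [Finset.mem_sigma, Finset.mem_filter, Finset.mem_univ, true_and,
      Finset.mem_erase] at h
    obtain ⟨⟨hP, ha⟩, hne, hB⟩ := h
    obtain ⟨m1, m2, m3⟩ := merge_isSetPart hP ha hB hne
    have hB' : B ∈ P.erase {a} := by simp [hne, hB]
    have : 0 < (P.erase {a}).card := Finset.card_pos.2 ⟨_, hB'⟩
    have h4 := Finset.card_erase_of_mem ha
    simp only [Finset.card_insert_of_notMem m3, Finset.card_erase_of_mem hB']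
    congr 1
    omega

theorem sum_finpartition {α : Type*} [Fintype α] [DecidableEq α] {K : Type*} [CommRing K]
    {s : Finset α} (hs : 2 ≤ s.card) :
    ∑ π : Finpartition s,
      (-1 : K) ^ (π.parts.card - 1) * (π.parts.card - 1).factorial = 0 := by
  classical
  rw [← sum_setPart (K := K) hs]
  refine Finset.sum_bij (fun π _ => π.parts) ?_ ?_ ?_ ?_
  · intro π _
    simpa using isSetPart_parts π
  · intro π _ σ _ h
    exact Finpartition.ext h
  · intro P hP
    simp only [Finset.mem_filter, Finset.mem_univ, true_and] at hP
    refine ⟨IsSetPart.toFin (by convert hP), by simp, rfl⟩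
  · intros; rfl

theorem prod_setPart {K : Type*} [CommRing K] {n : ℕ} 
    (a : Fin n → K × K)
    (x : Finset (Fin n) → K)
    (hx : ∀ I : Finset (Fin n), x I = (∏ i ∈ I, (a i).2) * ∏ i ∈ Iᶜ, (a i).1)
    (I : Finset (Fin n)) (hI : 2 ≤ I.card) (π : Finpartition I) :
    x ∅ ^ (n - π.parts.card) * ∏ B ∈ π.parts, x B = x ∅ ^ (n - 1) * x I := by
  have hle : π.parts.card ≤ n := by
    have h1 := π.card_parts_le_card
    have h2 := Finset.card_le_univ I
    simp at h2
    omega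
  have hpos : 0 < π.parts.card := by
    apply Finset.card_pos.2
    apply π.parts_nonempty
    rintro rfl
    simp at hI
  have hx' : ∀ J, x J = ∏ i, if i ∈ J then (a i).2 else (a i).1 := by
    intro J
    rw [hx, Finset.prod_ite]
    congr 2
    · ext; simp
    · ext; simp
  simp only [hx']
  rw [Finset.prod_comm]
  simp only [← Finset.prod_pow, ← Finset.prod_mul_distrib]
  refine Finset.prod_congr rfl fun i _ => ?_
  simp only [Finset.notMem_empty, if_false]
  by_cases hi : i ∈ I
  · obtain ⟨B, hB, hiB⟩ := π.exists_mem hi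
    rw [← Finset.mul_prod_erase _ _ hB, if_pos hiB, if_pos hi]
    rw [Finset.prod_congr rfl (g := fun _ => (a i).1)]
    · rw [Finset.prod_const, Finset.card_erase_of_mem hB, mul_left_comm, ← pow_add, mul_comm]
      congr 2
      omega
    · intro C hC
      rw [if_neg]
      intro h
      exact (Finset.mem_erase.1 hC).1
        (π.eq_of_mem_parts (Finset.mem_erase.1 hC).2 hB h hiB)
  · rw [Finset.prod_congr rfl (g := fun _ => (a i).1)]
    · rw [Finset.prod_const, ← pow_add, if_neg hi, ← pow_succ]
      congr 1
      omega
    · intro C hC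
      rw [if_neg]
      intro h
      exact hi (π.le hC h)


/-- Let `K` be a commutative ring, `n ≥ 1`, and `a : Fin n → K × K`.
For `I ⊆ [n]` let `x(I) = ∏_{i∈I} (a i).2 · ∏_{i∉I} (a i).1` (the coordinates of a point
of the Segre embedding of `(P¹)ⁿ`).  Then for every `I` with `|I| ≥ 2`,
`∑_{π ∈ Π(I)} (−1)^{|π|−1}·(|π|−1)!·x(∅)^{n−|π|}·∏_{B∈π} x(B) = 0`,
the sum being over all set partitions of `I`. -/
theorem cumulant_cremona_linearizes_segre {K : Type*} [CommRing K] {n : ℕ} (hn : 1 ≤ n)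
    (a : Fin n → K × K)
    (x : Finset (Fin n) → K)
    (hx : ∀ I : Finset (Fin n), x I = (∏ i ∈ I, (a i).2) * ∏ i ∈ Iᶜ, (a i).1) :
    ∀ I : Finset (Fin n), 2 ≤ I.card →
      ∑ π : Finpartition I,
        (-1 : K) ^ (π.parts.card - 1) * (π.parts.card - 1).factorial *
          x ∅ ^ (n - π.parts.card) * ∏ B ∈ π.parts, x B = 0 := by

  intro I hI
  have h := sum_finpartition (K := K) hI
  calc _ = ∑ π : Finpartition I, ((-1 : K) ^ (π.parts.card - 1) *
        (π.parts.card - 1).factorial) * (x ∅ ^ (n - 1) * x I) := by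
        refine Finset.sum_congr rfl fun π _ => ?_
        rw [mul_assoc, prod_setPart a x hx I hI π]
    _ = 0 := by rw [← Finset.sum_mul, h, zero_mul]
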